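/- arXiv:math/0210303 — 2 statements merged into one kernel-verified Lean document; each statement's English description precedes it below -/
import Mathlib

section
/- For each 1 ≤ k ≤ n, the set Γ_k^+ ⊂ ℝ^n, defined as the connected component of {λ : σ_k(λ) > 0} containing the positive cone, is an open convex cone with vertex at the origin. -/
open Matrix Finset

noncomputable def esym (n k : ℕ) (x : Fin n → ℝ) : ℝ :=
  ∑ s ∈ Finset.powersetCard k (Finset.univ : Finset (Fin n)), ∏ i ∈ s, x i

def Gamma (n k : ℕ) : Set (Fin n → ℝ) :=
  connectedComponentIn {x : Fin n → ℝ | 0 < esym n k x} (fun _ => 1)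

open Polynomial in
/-- If `w` is at least as close as `z` to every root of a complex polynomial, then the polynomial
is at most as large at `w` as at `z`. -/
theorem norm_eval_le_of_forall_root (F : ℂ[X]) (w z : ℂ)
    (h : ∀ r, F.eval r = 0 → ‖w - r‖ ≤ ‖z - r‖) : ‖F.eval w‖ ≤ ‖F.eval z‖ := by
  have hs := IsAlgClosed.splits F
  rw [hs.eval_eq_prod_roots, hs.eval_eq_prod_roots, norm_mul, norm_mul]
  refine mul_le_mul_of_nonneg_left ?_ (norm_nonneg _)
  have key : ∀ m : Multiset ℂ, (∀ r ∈ m, ‖w - r‖ ≤ ‖z - r‖) →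
      ‖(m.map fun a => w - a).prod‖ ≤ ‖(m.map fun a => z - a).prod‖ := by
    intro m
    induction m using Multiset.induction_on with
    | empty => simp
    | cons a m ih =>
      intro hm
      simp only [Multiset.map_cons, Multiset.prod_cons, norm_mul]
      exact mul_le_mul (hm a (Multiset.mem_cons_self a m))
        (ih fun r hr => hm r (Multiset.mem_cons_of_mem hr)) (norm_nonneg _) (norm_nonneg _)
  refine key _ fun r hr => h r ?_
  exact (mem_roots'.1 hr).2

open Polynomial in
/-- Iterated derivatives of a complex polynomial with only real roots have only real roots. -/
theorem im_eq_zero_of_eval_iterate_derivative_eq_zero (Q : ℂ[X])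
    (hQ : ∀ z, Q.eval z = 0 → z.im = 0) (j : ℕ) (hj : j < Q.natDegree) (z : ℂ)
    (hz : (derivative^[j] Q).eval z = 0) : z.im = 0 := by
  induction j generalizing z with
  | zero => exact hQ z hz
  | succ j ih =>
    have hdeg : ∀ m, (derivative^[m] Q).natDegree = Q.natDegree - m := by
      intro m
      induction m with
      | zero => simp
      | succ m ihm =>
        rw [Function.iterate_succ_apply', natDegree_derivative, ihm]
        omega
    have hne : derivative^[j + 1] Q ≠ 0 := by
      intro h0
      have := hdeg (j + 1)
      rw [h0, natDegree_zero] at this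
      omega
    have hpos : 0 < (derivative^[j] Q).degree := by
      rw [← natDegree_pos_iff_degree_pos, hdeg]
      omega
    rw [Function.iterate_succ_apply'] at hz hne
    have hmem : z ∈ convexHull ℝ ((derivative^[j] Q).rootSet ℂ) :=
      rootSet_derivative_subset_convexHull_rootSet hpos
        (mem_rootSet.2 ⟨hne, by rwa [coe_aeval_eq_eval]⟩)
    have hconv : Convex ℝ {w : ℂ | w.im = 0} := by
      intro u hu v hv a b _ _ _
      have hu' : u.im = 0 := hu
      have hv' : v.im = 0 := hv
      simp [hu', hv']
    refine convexHull_min (fun w hw => ?_) hconv hmem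
    have := (mem_rootSet.1 hw).2
    rw [coe_aeval_eq_eval] at this
    exact ih (by omega) w this

/-- The elementary symmetric polynomial of degree `k` in `n` complex variables. -/
noncomputable def esymComplex (n k : ℕ) (z : Fin n → ℂ) : ℂ :=
  ∑ s ∈ Finset.powersetCard k (Finset.univ : Finset (Fin n)), ∏ i ∈ s, z i

theorem esymComplex_ofReal (n k : ℕ) (x : Fin n → ℝ) :
    esymComplex n k (fun i => (x i : ℂ)) = (esym n k x : ℂ) := by
  simp [esymComplex, esym]

theorem esymComplex_conj (n k : ℕ) (z : Fin n → ℂ) :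
    esymComplex n k (fun i => (starRingEnd ℂ) (z i)) = (starRingEnd ℂ) (esymComplex n k z) := by
  simp [esymComplex]

theorem esymComplex_mul (n k : ℕ) (c : ℂ) (z : Fin n → ℂ) :
    esymComplex n k (fun i => c * z i) = c ^ k * esymComplex n k z := by
  simp only [esymComplex, Finset.mul_sum, Finset.prod_mul_distrib]
  refine Finset.sum_congr rfl fun s hs => ?_
  rw [Finset.prod_const, (Finset.mem_powersetCard.1 hs).2]

theorem esym_smul (n k : ℕ) (c : ℝ) (x : Fin n → ℝ) :
    esym n k (c • x) = c ^ k * esym n k x := by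
  simp only [esym, Finset.mul_sum, Pi.smul_apply, smul_eq_mul, Finset.prod_mul_distrib]
  refine Finset.sum_congr rfl fun s hs => ?_
  rw [Finset.prod_const, (Finset.mem_powersetCard.1 hs).2]

theorem continuous_esymComplex (n k : ℕ) : Continuous (esymComplex n k) := by
  unfold esymComplex
  fun_prop

theorem continuous_esym (n k : ℕ) : Continuous (esym n k) := by
  unfold esym
  fun_prop

theorem isOpen_esym_pos (n k : ℕ) : IsOpen {x : Fin n → ℝ | 0 < esym n k x} :=
  isOpen_lt continuous_const (continuous_esym n k)

theorem esym_pos_of_pos {n k : ℕ} (hk : k ≤ n) {x : Fin n → ℝ} (hx : ∀ i, 0 < x i) :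
    0 < esym n k x := by
  refine Finset.sum_pos (fun s _ => Finset.prod_pos fun i _ => hx i) ?_
  exact Finset.powersetCard_nonempty.2 (by simpa using hk)

open Polynomial in
theorem exists_polynomial_eval_eq_esymComplex (n k : ℕ) (u v : Fin n → ℂ) :
    ∃ F : ℂ[X], ∀ ζ, F.eval ζ = esymComplex n k (fun i => u i + ζ * v i) := by
  refine ⟨∑ s ∈ Finset.powersetCard k (Finset.univ : Finset (Fin n)),
    ∏ i ∈ s, (C (u i) + C (v i) * X), fun ζ => ?_⟩
  simp only [esymComplex, eval_finsetSum, eval_prod, eval_add, eval_mul, eval_C, eval_X,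
    mul_comm ζ]

/-- `σ_k` is hyperbolic in the direction `b`: along every real line with direction `b`, it has only
real zeros. -/
def EsymHyperbolic (n k : ℕ) (b : Fin n → ℝ) : Prop :=
  ∀ (x : Fin n → ℝ) (ζ : ℂ), esymComplex n k (fun i => x i + ζ * b i) = 0 → ζ.im = 0

open Polynomial in
theorem esymHyperbolic_one {n k : ℕ} (h1 : 1 ≤ k) (hk : k ≤ n) :
    EsymHyperbolic n k (fun _ => 1) := by
  intro x ζ h
  set Q : ℂ[X] := ∏ i : Fin n, (X + C (x i : ℂ)) with hQ
  have hdeg : Q.natDegree = n := by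
    rw [hQ, natDegree_prod_of_monic _ _ fun i _ => monic_X_add_C _]
    simp
  have hroots : ∀ z, Q.eval z = 0 → z.im = 0 := by
    intro z hz
    rw [hQ, eval_prod, Finset.prod_eq_zero_iff] at hz
    obtain ⟨i, -, hi⟩ := hz
    have := congrArg Complex.im hi
    simpa using this
  refine im_eq_zero_of_eval_iterate_derivative_eq_zero Q hroots (n - k) (by omega) ζ ?_
  have htaylor : taylor ζ Q = ∏ i : Fin n, (X + C ((x i : ℂ) + ζ * ((1 : ℝ) : ℂ))) := by
    rw [hQ, taylor_apply, Polynomial.prod_comp]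
    refine Finset.prod_congr rfl fun i _ => ?_
    simp
    ring
  have hcoeff : (hasseDeriv (n - k) Q).eval ζ = 0 := by
    rw [← taylor_coeff, htaylor, Finset.prod_X_add_C_coeff _ _ (by simp)]
    rw [Finset.card_univ, Fintype.card_fin, Nat.sub_sub_self hk]
    exact h
  rw [← factorial_smul_hasseDeriv]
  simp [hcoeff]

theorem esym_add_smul_pos {n k : ℕ} {x b : Fin n → ℝ}
    (h : segment ℝ x b ⊆ {y | 0 < esym n k y}) {s : ℝ} (hs : 0 ≤ s) :
    0 < esym n k (x + s • b) := by
  have h1 : 0 < 1 + s := by linarith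
  have hmem : (1 + s)⁻¹ • (x + s • b) ∈ segment ℝ x b := by
    refine ⟨(1 + s)⁻¹, (1 + s)⁻¹ * s, by positivity, by positivity, by field_simp, ?_⟩
    rw [smul_add, smul_smul]
  have h2 : 0 < esym n k ((1 + s)⁻¹ • (x + s • b)) := h hmem
  rw [esym_smul] at h2
  exact pos_of_mul_pos_right h2 (by positivity)

theorem esymComplex_line_ofReal (n k : ℕ) (x b : Fin n → ℝ) (s : ℝ) :
    esymComplex n k (fun i => x i + (s : ℂ) * b i) = (esym n k (x + s • b) : ℂ) := by
  rw [← esymComplex_ofReal]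
  simp

theorem EsymHyperbolic.esym_le_esym_add_smul {n k : ℕ} {x b : Fin n → ℝ}
    (hb : EsymHyperbolic n k b) (h : segment ℝ x b ⊆ {y | 0 < esym n k y}) {s : ℝ}
    (hs : 0 ≤ s) : esym n k x ≤ esym n k (x + s • b) := by
  obtain ⟨F, hF⟩ := exists_polynomial_eval_eq_esymComplex n k (fun i => x i) (fun i => b i)
  have key := norm_eval_le_of_forall_root F ((0 : ℝ) : ℂ) (s : ℂ) fun r hr => by
    rw [hF] at hr
    obtain ⟨t, rfl⟩ : ∃ t : ℝ, (t : ℂ) = r := ⟨r.re, Complex.ext rfl (by simp [hb x r hr])⟩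
    have ht : t < 0 := by
      by_contra! ht
      rw [esymComplex_line_ofReal] at hr
      exact (esym_add_smul_pos h ht).ne' (by exact_mod_cast hr)
    rw [← Complex.ofReal_sub, ← Complex.ofReal_sub, Complex.norm_real, Complex.norm_real,
      Real.norm_of_nonneg (by linarith), Real.norm_of_nonneg (by linarith)]
    linarith
  rw [hF, hF, esymComplex_line_ofReal, esymComplex_line_ofReal, Complex.norm_real,
    Complex.norm_real, Real.norm_of_nonneg (esym_add_smul_pos h le_rfl).le,
    Real.norm_of_nonneg (esym_add_smul_pos h hs).le] at key
  simpa using key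

/-- The component of `{σ_k > 0}` containing a direction of hyperbolicity `b` consists of the points
that can be joined to `b` by a segment on which `σ_k` is positive. -/
theorem EsymHyperbolic.connectedComponentIn_eq {n k : ℕ} {b : Fin n → ℝ}
    (hb : EsymHyperbolic n k b) (hpos : 0 < esym n k b) :
    connectedComponentIn {y | 0 < esym n k y} b =
      {x | segment ℝ x b ⊆ {y | 0 < esym n k y}} := by
  refine Set.Subset.antisymm ?_ fun x hx => ?_
  · have hopen : IsOpen {x | segment ℝ x b ⊆ {y | 0 < esym n k y}} := by
      rw [isOpen_iff_mem_nhds]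
      intro x hx
      have := (isCompact_Icc (a := (0 : ℝ)) (b := 1)).eventually_forall_of_forall_eventually
        (x₀ := x) (P := fun y s => 0 < esym n k (y + s • (b - y))) fun s hs => by
          have hc : Continuous fun z : (Fin n → ℝ) × ℝ => esym n k (z.1 + z.2 • (b - z.1)) :=
            (continuous_esym n k).comp (by fun_prop)
          refine hc.continuousAt.eventually (lt_mem_nhds ?_)
          exact hx (by rw [segment_eq_image']; exact ⟨s, hs, rfl⟩)
      filter_upwards [this] with y hy
      rw [segment_eq_image']
      rintro _ ⟨s, hs, rfl⟩
      exact hy s hs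
    refine isPreconnected_connectedComponentIn.subset_of_closure_inter_subset hopen
      ⟨b, mem_connectedComponentIn hpos, ?_⟩ ?_
    · simpa [segment_same] using hpos
    · rintro x ⟨hx, hxc⟩
      have hx0 : 0 < esym n k x :=
        connectedComponentIn_subset {y : Fin n → ℝ | 0 < esym n k y} _ hxc
      have hle : ∀ s : ℝ, 0 ≤ s → esym n k x ≤ esym n k (x + s • b) := by
        intro s hs
        have hclosed : IsClosed {y | esym n k y ≤ esym n k (y + s • b)} :=
          isClosed_le (continuous_esym n k) ((continuous_esym n k).comp (by fun_prop))
        exact closure_minimal (fun y hy => hb.esym_le_esym_add_smul hy hs) hclosed hx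
      rintro _ ⟨p, q, hp, hq, hpq, rfl⟩
      rcases hp.eq_or_lt with rfl | hp
      · obtain rfl : q = 1 := by linarith
        simpa using hpos
      · have : p • x + q • b = p • (x + (p⁻¹ * q) • b) := by
          rw [smul_add, smul_smul, mul_inv_cancel_left₀ hp.ne']
        rw [Set.mem_ofPred_eq, this, esym_smul]
        have := hle (p⁻¹ * q) (by positivity)
        have : 0 < esym n k (x + (p⁻¹ * q) • b) := by linarith
        positivity
  · exact (convex_segment x b).isPreconnected.subset_connectedComponentIn
      (right_mem_segment ℝ x b) hx (left_mem_segment ℝ x b)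

theorem norm_sub_le_norm_sub_of_im {w z r : ℂ} (hre : w.re = z.re) (hr : r.im ≤ w.im)
    (him : w.im ≤ z.im) : ‖w - r‖ ≤ ‖z - r‖ := by
  rw [← sq_le_sq₀ (norm_nonneg _) (norm_nonneg _), ← Complex.normSq_eq_norm_sq,
    ← Complex.normSq_eq_norm_sq, Complex.normSq_apply, Complex.normSq_apply]
  simp only [Complex.sub_re, Complex.sub_im, hre]
  nlinarith

theorem EsymHyperbolic.esymComplex_I_mul_add_ofReal_ne_zero {n k : ℕ} {e b : Fin n → ℝ}
    (he : EsymHyperbolic n k e) (x : Fin n → ℝ) (t : ℝ) :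
    esymComplex n k (fun i => Complex.I * e i + x i + t * b i) ≠ 0 := by
  intro h
  have := he (x + t • b) Complex.I (by
    rw [← h]
    congr 1
    funext i
    simp
    ring)
  simp at this

theorem EsymHyperbolic.esymComplex_I_mul_add_mul_ne_zero {n k : ℕ} {e b : Fin n → ℝ}
    (he : EsymHyperbolic n k e) (hpos : 0 < esym n k e)
    (hseg : segment ℝ b e ⊆ {y | 0 < esym n k y}) (ζ : ℂ) (hζ : 0 ≤ ζ.im) :
    esymComplex n k (fun i => Complex.I * e i + ζ * b i) ≠ 0 := by
  intro h
  rcases eq_or_ne ζ 0 with rfl | h0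
  · have : esymComplex n k (fun i => Complex.I * (e i : ℂ)) = 0 := by simpa using h
    rw [esymComplex_mul, esymComplex_ofReal] at this
    simp [hpos.ne'] at this
  · have hfac : (fun i => Complex.I * (e i : ℂ) + ζ * b i) =
        fun i => ζ * ((b i : ℂ) + (Complex.I / ζ) * e i) := by
      funext i
      field_simp
      ring
    rw [hfac, esymComplex_mul, mul_eq_zero, or_iff_right (pow_ne_zero _ h0)] at h
    have him := he b _ h
    obtain ⟨t, ht⟩ : ∃ t : ℝ, (t : ℂ) = Complex.I / ζ :=
      ⟨(Complex.I / ζ).re, Complex.ext rfl (by simp [him])⟩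
    have hneg : t < 0 := by
      by_contra! hle
      rw [← ht, esymComplex_line_ofReal] at h
      exact (esym_add_smul_pos hseg hle).ne' (by exact_mod_cast h)
    rw [eq_div_iff h0] at ht
    have := congrArg Complex.im ht
    simp at this
    nlinarith

theorem EsymHyperbolic.esymComplex_I_mul_add_ne_zero {n k : ℕ} {e b : Fin n → ℝ}
    (he : EsymHyperbolic n k e) (hpos : 0 < esym n k e)
    (hseg : segment ℝ b e ⊆ {y | 0 < esym n k y}) (x : Fin n → ℝ) (ζ : ℂ) (hζ : 0 ≤ ζ.im) :
    esymComplex n k (fun i => Complex.I * e i + x i + ζ * b i) ≠ 0 := by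
  set G : Set (Fin n → ℝ) := {x | ∀ ζ : ℂ, 0 ≤ ζ.im →
    esymComplex n k (fun i => Complex.I * e i + x i + ζ * b i) ≠ 0}
  suffices hclopen : IsClopen G by
    have huniv := hclopen.eq_univ ⟨0, fun ζ hζ => by
      simpa using he.esymComplex_I_mul_add_mul_ne_zero hpos hseg ζ hζ⟩
    exact (huniv ▸ Set.mem_univ x : x ∈ G) ζ hζ
  have hbpos : 0 < esym n k b := hseg (left_mem_segment ℝ b e)
  constructor
  · refine isClosed_of_closure_subset fun x hx ζ hζ h => ?_
    have hclosed : IsClosed {y : Fin n → ℝ |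
        ‖esymComplex n k (fun i => Complex.I * e i + y i + (ζ.re : ℂ) * b i)‖ ≤
        ‖esymComplex n k (fun i => Complex.I * e i + y i + ζ * b i)‖} :=
      isClosed_le ((continuous_esymComplex n k).comp (by fun_prop)).norm
        ((continuous_esymComplex n k).comp (by fun_prop)).norm
    have hle := closure_minimal (fun y hy => ?_) hclosed hx
    · rw [Set.mem_ofPred_eq, h, norm_zero, norm_le_zero_iff] at hle
      exact he.esymComplex_I_mul_add_ofReal_ne_zero x ζ.re hle
    · obtain ⟨F, hF⟩ := exists_polynomial_eval_eq_esymComplex n k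
        (fun i => Complex.I * e i + y i) (fun i => b i)
      rw [Set.mem_ofPred_eq, ← hF, ← hF]
      refine norm_eval_le_of_forall_root F _ _ fun r hr => ?_
      have hneg : r.im < 0 := by
        by_contra! hle
        exact hy r hle (by rw [← hF, hr])
      exact norm_sub_le_norm_sub_of_im (by simp) (by simpa using hneg.le) (by simpa using hζ)
  · -- After homogenizing, the pair of parameters ranges over a compact set.
    set K : Set (ℝ × ℂ) := Metric.sphere 0 1 ∩ {q | 0 ≤ q.1 ∧ 0 ≤ q.2.im}
    have hKc : IsCompact K := (isCompact_sphere _ _).inter_right <|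
      (isClosed_le continuous_const continuous_fst).inter
        (isClosed_le continuous_const (Complex.continuous_im.comp continuous_snd))
    have hscale : ∀ (y : Fin n → ℝ) (m : ℝ) (ζ : ℂ), m ≠ 0 →
        esymComplex n k (fun i => m * (Complex.I * e i + y i) + ζ * b i) =
        (m : ℂ) ^ k * esymComplex n k (fun i => Complex.I * e i + y i + (ζ / m) * b i) := by
      intro y m ζ hm
      rw [← esymComplex_mul]
      congr 1
      funext i
      have : (m : ℂ) ≠ 0 := by exact_mod_cast hm
      field_simp
    rw [isOpen_iff_mem_nhds]
    intro x hx
    have := hKc.eventually_forall_of_forall_eventually (x₀ := x)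
      (P := fun y q => esymComplex n k
        (fun i => (q.1 : ℂ) * (Complex.I * e i + y i) + q.2 * b i) ≠ 0) fun q hq => by
          have hc : Continuous fun z : (Fin n → ℝ) × (ℝ × ℂ) => esymComplex n k
              (fun i => (z.2.1 : ℂ) * (Complex.I * e i + z.1 i) + z.2.2 * b i) :=
            (continuous_esymComplex n k).comp (by fun_prop)
          refine hc.continuousAt.eventually_ne ?_
          obtain ⟨m, ζ⟩ := q
          obtain ⟨hq1, hm, hζ⟩ := hq
          simp only at hm hζ ⊢
          rcases hm.eq_or_lt with rfl | hm
          · have h0 : ζ ≠ 0 := by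
              rintro rfl
              simp at hq1
            have : esymComplex n k (fun i => ζ * (b i : ℂ)) ≠ 0 := by
              rw [esymComplex_mul, esymComplex_ofReal]
              exact mul_ne_zero (pow_ne_zero _ h0) (by exact_mod_cast hbpos.ne')
            simpa using this
          · rw [hscale _ _ _ hm.ne']
            refine mul_ne_zero (pow_ne_zero _ (by exact_mod_cast hm.ne')) (hx _ ?_)
            rw [Complex.div_ofReal_im]
            positivity
    filter_upwards [this] with y hy ζ hζ
    have hN : 0 < ‖((1 : ℝ), ζ)‖ := norm_pos_iff.2 (by simp)
    set N := ‖((1 : ℝ), ζ)‖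
    have hmem : N⁻¹ • ((1 : ℝ), ζ) ∈ K := by
      refine ⟨?_, ?_, ?_⟩
      · rw [mem_sphere_zero_iff_norm, norm_smul, norm_inv, norm_norm]
        exact inv_mul_cancel₀ hN.ne'
      · simp only [Prod.smul_fst, smul_eq_mul, mul_one]
        positivity
      · simp only [Prod.smul_snd, Complex.smul_im, smul_eq_mul]
        positivity
    have h := hy _ hmem
    simp only [Prod.smul_mk, smul_eq_mul, mul_one, Complex.real_smul] at h
    rw [hscale _ _ _ (by positivity)] at h
    have hNC : ((N⁻¹ : ℝ) : ℂ) ≠ 0 := by exact_mod_cast (inv_pos.2 hN).ne'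
    rw [mul_div_cancel_left₀ _ hNC] at h
    exact right_ne_zero_of_mul h

theorem esymComplex_line_ne_zero {n k : ℕ} {b : Fin n → ℝ} (hb : 0 < esym n k b)
    (x : Fin n → ℝ) : ∃ t : ℂ, esymComplex n k (fun i => x i + t * b i) ≠ 0 := by
  have hc : Continuous fun s : ℝ => esym n k (b + s • x) :=
    (continuous_esym n k).comp (by fun_prop)
  have hev : ∀ᶠ s in nhds (0 : ℝ), 0 < esym n k (b + s • x) :=
    hc.continuousAt.eventually (lt_mem_nhds (by simpa using hb))
  obtain ⟨s, hs, hs0⟩ := ((hev.filter_mono nhdsWithin_le_nhds).and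
    (self_mem_nhdsWithin (s := Set.Ioi (0 : ℝ)))).exists
  have hs0' : s ≠ 0 := (Set.mem_Ioi.1 hs0).ne'
  refine ⟨((s⁻¹ : ℝ) : ℂ), fun h => hs.ne' ?_⟩
  rw [esymComplex_line_ofReal, Complex.ofReal_eq_zero] at h
  have : b + s • x = s • (x + s⁻¹ • b) := by
    rw [smul_add, smul_smul, mul_inv_cancel₀ hs0', one_smul, add_comm]
  rw [this, esym_smul, h, mul_zero]

/-- Hyperbolicity of `σ_k` spreads from a direction `e` to all points visible from `e` inside
`{σ_k > 0}`. -/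
theorem EsymHyperbolic.of_segment_subset {n k : ℕ} {e b : Fin n → ℝ}
    (he : EsymHyperbolic n k e) (hpos : 0 < esym n k e)
    (hseg : segment ℝ b e ⊆ {y | 0 < esym n k y}) : EsymHyperbolic n k b := by
  have hbpos : 0 < esym n k b := hseg (left_mem_segment ℝ b e)
  have upper : ∀ (x : Fin n → ℝ) (ζ : ℂ), 0 < ζ.im →
      esymComplex n k (fun i => x i + ζ * b i) ≠ 0 := by
    intro x ζ hζ hzero
    have hvanish : ∀ τ ∈ Set.Icc 0 ζ.im,
        esymComplex n k (fun i => x i + (⟨ζ.re, τ⟩ : ℂ) * b i) = 0 := by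
      intro τ hτ
      have hclosed : IsClosed {δ : ℝ |
          ‖esymComplex n k (fun i => (δ * (Complex.I * e i) + x i) + (⟨ζ.re, τ⟩ : ℂ) * b i)‖ ≤
          ‖esymComplex n k (fun i => (δ * (Complex.I * e i) + x i) + ζ * b i)‖} :=
        isClosed_le ((continuous_esymComplex n k).comp (by fun_prop)).norm
          ((continuous_esymComplex n k).comp (by fun_prop)).norm
      have hle := closure_minimal (s := Set.Ioi (0 : ℝ)) (fun δ hδ => ?_) hclosed
        (by rw [closure_Ioi]; exact Set.self_mem_Ici : (0 : ℝ) ∈ closure (Set.Ioi 0))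
      · simpa [hzero] using hle
      · obtain ⟨F, hF⟩ := exists_polynomial_eval_eq_esymComplex n k
          (fun i => δ * (Complex.I * e i) + x i) (fun i => b i)
        rw [Set.mem_ofPred_eq, ← hF, ← hF]
        refine norm_eval_le_of_forall_root F _ _ fun r hr => ?_
        have hδ0 : 0 < δ := hδ
        have hδC : (δ : ℂ) ≠ 0 := by exact_mod_cast hδ0.ne'
        have hneg : r.im < 0 := by
          by_contra! hle
          refine he.esymComplex_I_mul_add_ne_zero hpos hseg (δ⁻¹ • x) (r / δ) ?_ ?_
          · rw [Complex.div_ofReal_im]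
            positivity
          · rw [hF] at hr
            have hfac : (fun i => (δ * (Complex.I * e i) + x i : ℂ) + r * b i) = fun i =>
                (δ : ℂ) * (Complex.I * e i + ((δ⁻¹ • x) i : ℝ) + r / δ * b i) := by
              funext i
              simp
              field_simp
            rw [hfac, esymComplex_mul] at hr
            exact (mul_eq_zero.1 hr).resolve_left (pow_ne_zero _ hδC)
        exact norm_sub_le_norm_sub_of_im rfl (hneg.le.trans hτ.1) hτ.2
    obtain ⟨F, hF⟩ := exists_polynomial_eval_eq_esymComplex n k (fun i => x i) (fun i => b i)
    have hF0 : F = 0 := by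
      refine Polynomial.eq_zero_of_infinite_isRoot F ?_
      refine ((Set.Icc_infinite hζ).image (f := fun τ : ℝ => (⟨ζ.re, τ⟩ : ℂ)) ?_).mono ?_
      · intro p _ q _ hpq
        exact congrArg Complex.im hpq
      · rintro _ ⟨τ, hτ, rfl⟩
        exact (hF _).trans (hvanish τ hτ)
    obtain ⟨t, ht⟩ := esymComplex_line_ne_zero hbpos x
    exact ht (by rw [← hF, hF0, Polynomial.eval_zero])
  intro x ζ hζ
  rcases lt_trichotomy ζ.im 0 with h | h | h
  · refine absurd ?_ (upper x ((starRingEnd ℂ) ζ) (by simpa using h))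
    have := esymComplex_conj n k (fun i => x i + ζ * b i)
    rw [hζ, map_zero] at this
    simpa using this
  · exact h
  · exact absurd hζ (upper x ζ h)

/-- `Γ_k^+`, the connected component of `{σ_k > 0}` containing the positive cone, is an
open convex cone with vertex at the origin (and it does contain the positive cone). -/
theorem Gamma_open_convex_cone (n k : ℕ) (h1 : 1 ≤ k) (hk : k ≤ n) :
    IsOpen (Gamma n k) ∧ Convex ℝ (Gamma n k) ∧
      (∀ x ∈ Gamma n k, ∀ c : ℝ, 0 < c → c • x ∈ Gamma n k) ∧
      {x : Fin n → ℝ | ∀ i, 0 < x i} ⊆ Gamma n k := by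
  have he : EsymHyperbolic n k (fun _ => 1) := esymHyperbolic_one h1 hk
  have hpos : 0 < esym n k (fun _ => 1) := esym_pos_of_pos hk fun _ => one_pos
  refine ⟨(isOpen_esym_pos n k).connectedComponentIn, ?_, fun x hx c hc => ?_, ?_⟩
  · rw [convex_iff_segment_subset]
    intro x hx b hb
    have hbseg : segment ℝ b (fun _ => 1) ⊆ {y | 0 < esym n k y} := by
      rw [Gamma, he.connectedComponentIn_eq hpos] at hb
      exact hb
    have hxb : x ∈ connectedComponentIn {y | 0 < esym n k y} b := by
      rw [← connectedComponentIn_eq hb]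
      exact hx
    rw [(he.of_segment_subset hpos hbseg).connectedComponentIn_eq
      (hbseg (left_mem_segment ℝ _ _))] at hxb
    rw [Gamma, connectedComponentIn_eq hb]
    exact (convex_segment x b).isPreconnected.subset_connectedComponentIn
      (right_mem_segment ℝ x b) hxb
  · have hx0 : 0 < esym n k x :=
      connectedComponentIn_subset {y : Fin n → ℝ | 0 < esym n k y} _ hx
    rw [Gamma, connectedComponentIn_eq hx]
    refine ((isPreconnected_Ioi (a := (0 : ℝ))).image (fun t : ℝ => t • x)
      (by fun_prop)).subset_connectedComponentIn ⟨1, by simp, one_smul ℝ x⟩ ?_ ⟨c, hc, rfl⟩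
    rintro _ ⟨t, ht, rfl⟩
    have ht0 : 0 < t := ht
    rw [Set.mem_ofPred_eq, esym_smul]
    positivity
  · have hconv : Convex ℝ {x : Fin n → ℝ | ∀ i, 0 < x i} := by
      have : {x : Fin n → ℝ | ∀ i, 0 < x i} = Set.univ.pi fun _ => Set.Ioi 0 := by
        ext
        simp
      rw [this]
      exact convex_pi fun _ _ => convex_Ioi 0
    exact hconv.isPreconnected.subset_connectedComponentIn (fun _ => one_pos)
      fun x hx => esym_pos_of_pos hk hx
end

section
/- The function A ↦ σ_k(A)^{1/k} is concave on the set of symmetric n×n matrices whose eigenvalues lie in Γ_k^+; that is, for such A, B and t ∈ [0,1], σ_k((1−t)A + tB)^{1/k} ≥ (1−t) σ_k(A)^{1/k} + t σ_k(B)^{1/k}. -/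
open Matrix Finset

/-- `σ_k(A)`: the `k`-th elementary symmetric polynomial of the eigenvalues of a
symmetric (Hermitian) real matrix `A` (junk value `0` otherwise). -/
noncomputable def msigma {n : ℕ} (k : ℕ) (A : Matrix (Fin n) (Fin n) ℝ) : ℝ :=
  if h : A.IsHermitian then esym n k h.eigenvalues else 0

/-- The `q`-th Newton transformation `T_q(A) = ∑_{i=0}^q (-1)^i σ_{q-i}(A) A^i`. -/
noncomputable def newton {n : ℕ} (q : ℕ) (A : Matrix (Fin n) (Fin n) ℝ) :
    Matrix (Fin n) (Fin n) ℝ :=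
  ∑ i ∈ Finset.range (q + 1), ((-1 : ℝ) ^ i * msigma (q - i) A) • A ^ i

/-- A symmetric matrix lies in `Γ_k^+` if its eigenvalue vector does. -/
def inGamma (n k : ℕ) (A : Matrix (Fin n) (Fin n) ℝ) : Prop :=
  ∃ h : A.IsHermitian, h.eigenvalues ∈ Gamma n k

section ElementarySymmetric

variable {ι : Type*}

/-- The `k`-th elementary symmetric polynomial of the coordinates of `x` in `s`. -/
def esymOn (s : Finset ι) (k : ℕ) (x : ι → ℝ) : ℝ :=
  ∑ t ∈ s.powersetCard k, ∏ i ∈ t, x i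

theorem esymOn_zero (s : Finset ι) (x : ι → ℝ) : esymOn s 0 x = 1 := by
  simp [esymOn]

theorem esymOn_one (s : Finset ι) (x : ι → ℝ) : esymOn s 1 x = ∑ i ∈ s, x i := by
  simp [esymOn, Finset.powersetCard_one]

theorem esymOn_smul (s : Finset ι) (k : ℕ) (c : ℝ) (x : ι → ℝ) :
    esymOn s k (c • x) = c ^ k * esymOn s k x := by
  unfold esymOn
  rw [Finset.mul_sum]
  refine Finset.sum_congr rfl fun t ht => ?_
  simp [Finset.prod_mul_distrib, (Finset.mem_powersetCard.mp ht).2]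

/-- The vectors whose elementary symmetric polynomials up to degree `k` over `s` are positive. -/
def esymCone (s : Finset ι) (k : ℕ) : Set (ι → ℝ) := {x | ∀ j ≤ k, 0 < esymOn s j x}

theorem esymCone_anti (s : Finset ι) {j k : ℕ} (h : j ≤ k) : esymCone s k ⊆ esymCone s j :=
  fun _ hx i hi => hx i (hi.trans h)

theorem mem_esymCone_succ {s : Finset ι} {k : ℕ} {x : ι → ℝ} :
    x ∈ esymCone s (k + 1) ↔ x ∈ esymCone s k ∧ 0 < esymOn s (k + 1) x := by
  refine ⟨fun h => ⟨esymCone_anti s k.le_succ h, h _ le_rfl⟩, fun h j hj => ?_⟩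
  rcases Nat.le_succ_iff.mp hj with hj | rfl
  exacts [h.1 j hj, h.2]

theorem smul_mem_esymCone {s : Finset ι} {k : ℕ} {x : ι → ℝ} (hx : x ∈ esymCone s k)
    {c : ℝ} (hc : 0 < c) : c • x ∈ esymCone s k := fun j hj => by
  rw [esymOn_smul]
  exact mul_pos (pow_pos hc j) (hx j hj)

/-- The ratio of two consecutive elementary symmetric polynomials. -/
noncomputable def esymRatio (s : Finset ι) (k : ℕ) (x : ι → ℝ) : ℝ :=
  esymOn s (k + 1) x / esymOn s k x

theorem prod_esymRatio {s : Finset ι} {k : ℕ} {x : ι → ℝ} (hx : x ∈ esymCone s k) :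
    ∏ j ∈ Finset.range k, esymRatio s j x = esymOn s k x := by
  induction k with
  | zero => simp [esymOn_zero]
  | succ k ih =>
    have hx' := esymCone_anti s k.le_succ hx
    rw [Finset.prod_range_succ, ih hx', esymRatio, mul_div_cancel₀ _ (hx' k le_rfl).ne']

variable [DecidableEq ι]

theorem esymOn_succ_of_mem {s : Finset ι} {i : ι} (hi : i ∈ s) (k : ℕ) (x : ι → ℝ) :
    esymOn s (k + 1) x = x i * esymOn (s.erase i) k x + esymOn (s.erase i) (k + 1) x := by
  have hne : i ∉ s.erase i := Finset.notMem_erase i s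
  unfold esymOn
  conv_lhs => rw [← Finset.insert_erase hi, Finset.powersetCard_succ_insert hne]
  rw [Finset.sum_union, Finset.sum_image, Finset.mul_sum, add_comm]
  · congr 1
    refine Finset.sum_congr rfl fun t ht => Finset.prod_insert fun h => ?_
    exact hne ((Finset.mem_powersetCard.mp ht).1 h)
  · intro t ht u hu h
    have h1 : i ∉ t := fun h => hne ((Finset.mem_powersetCard.mp ht).1 h)
    have h2 : i ∉ u := fun h => hne ((Finset.mem_powersetCard.mp hu).1 h)
    rw [← Finset.erase_insert h1, ← Finset.erase_insert h2]
    exact congrArg (fun v => v.erase i) h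
  · rw [Finset.disjoint_left]
    intro t ht hu
    obtain ⟨u, -, rfl⟩ := Finset.mem_image.mp hu
    exact hne ((Finset.mem_powersetCard.mp ht).1 (Finset.mem_insert_self i u))

theorem sum_mul_esymOn_erase (s : Finset ι) (k : ℕ) (x : ι → ℝ) :
    ∑ i ∈ s, x i * esymOn (s.erase i) k x = (k + 1) * esymOn s (k + 1) x := by
  have key : ∀ i ∈ s, x i * esymOn (s.erase i) k x =
      ∑ t ∈ s.powersetCard (k + 1), if i ∈ t then ∏ j ∈ t, x j else 0 := by
    intro i hi
    have hf : (s.erase i).powersetCard (k + 1) =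
        (s.powersetCard (k + 1)).filter fun t => i ∉ t := by
      ext t
      simp only [Finset.mem_powersetCard, Finset.mem_filter, Finset.subset_erase]
      tauto
    have h := esymOn_succ_of_mem hi k x
    unfold esymOn at h ⊢
    rw [hf, ← Finset.sum_filter_add_sum_filter_not (s.powersetCard (k + 1)) (fun t => i ∈ t)] at h
    rw [← Finset.sum_filter]
    linarith
  rw [Finset.sum_congr rfl key, Finset.sum_comm, esymOn, Finset.mul_sum]
  refine Finset.sum_congr rfl fun t ht => ?_
  obtain ⟨hts, htc⟩ := Finset.mem_powersetCard.mp ht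
  rw [← Finset.sum_filter, Finset.filter_mem_eq_inter, Finset.inter_eq_right.mpr hts,
    Finset.sum_const, htc, nsmul_eq_mul]
  push_cast
  ring

/-- A weak form of Newton's inequality. -/
theorem esymOn_mul_le_sq (s : Finset ι) (k : ℕ) (x : ι → ℝ) :
    esymOn s k x * esymOn s (k + 2) x ≤ esymOn s (k + 1) x ^ 2 := by
  induction k generalizing s with
  | zero =>
    have h : ∑ i ∈ s, x i ^ 2 = esymOn s 1 x ^ 2 - 2 * esymOn s 2 x := by
      have h2 := sum_mul_esymOn_erase s 1 x
      have h1 : ∀ i ∈ s, x i ^ 2 = x i * esymOn s 1 x - x i * esymOn (s.erase i) 1 x := by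
        intro i hi
        rw [esymOn_succ_of_mem hi 0, esymOn_zero]
        ring
      rw [Finset.sum_congr rfl h1, Finset.sum_sub_distrib, ← Finset.sum_mul, h2, ← esymOn_one]
      norm_num
      ring
    have h0 : 0 ≤ ∑ i ∈ s, x i ^ 2 := Finset.sum_nonneg fun i _ => sq_nonneg _
    rw [esymOn_zero]
    norm_num
    nlinarith [sq_nonneg (esymOn s 1 x)]
  | succ k ih =>
    have h : ∑ i ∈ s, x i ^ 2 * (esymOn (s.erase i) (k + 1) x ^ 2 -
        esymOn (s.erase i) k x * esymOn (s.erase i) (k + 2) x) =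
        (k + 2) * esymOn s (k + 2) x ^ 2 -
          (k + 3) * (esymOn s (k + 1) x * esymOn s (k + 3) x) := by
      have h1 : ∀ i ∈ s, x i ^ 2 * (esymOn (s.erase i) (k + 1) x ^ 2 -
          esymOn (s.erase i) k x * esymOn (s.erase i) (k + 2) x) =
          x i * esymOn (s.erase i) (k + 1) x * esymOn s (k + 2) x -
            x i * esymOn (s.erase i) (k + 2) x * esymOn s (k + 1) x := by
        intro i hi
        rw [esymOn_succ_of_mem hi (k + 1), esymOn_succ_of_mem hi k]
        ring
      rw [Finset.sum_congr rfl h1, Finset.sum_sub_distrib, ← Finset.sum_mul, ← Finset.sum_mul,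
        sum_mul_esymOn_erase, sum_mul_esymOn_erase]
      push_cast
      ring
    have h0 : 0 ≤ ∑ i ∈ s, x i ^ 2 * (esymOn (s.erase i) (k + 1) x ^ 2 -
        esymOn (s.erase i) k x * esymOn (s.erase i) (k + 2) x) :=
      Finset.sum_nonneg fun i _ => mul_nonneg (sq_nonneg _) (sub_nonneg.mpr (ih _))
    have hk : (0 : ℝ) < k + 3 := by positivity
    have : 0 ≤ (k + 3 : ℝ) * (esymOn s (k + 2) x ^ 2 - esymOn s (k + 1) x * esymOn s (k + 3) x) := by
      nlinarith [sq_nonneg (esymOn s (k + 2) x)]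
    exact sub_nonneg.mp (nonneg_of_mul_nonneg_right this hk)

theorem mem_esymCone_erase {s : Finset ι} {k : ℕ} {x : ι → ℝ} (hx : x ∈ esymCone s (k + 1))
    {i : ι} (hi : i ∈ s) : x ∈ esymCone (s.erase i) k := by
  induction k with
  | zero =>
    intro j hj
    rw [Nat.le_zero.mp hj, esymOn_zero]
    exact one_pos
  | succ k ih =>
    have hc := ih (esymCone_anti s (Nat.le_succ _) hx)
    refine mem_esymCone_succ.mpr ⟨hc, ?_⟩
    have h0 := hc k le_rfl
    have h1 := hx (k + 1) (Nat.le_succ _)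
    have h2 := hx (k + 2) le_rfl
    rw [esymOn_succ_of_mem hi] at h1 h2
    have hN := esymOn_mul_le_sq (s.erase i) k x
    by_contra hneg
    rw [not_lt] at hneg
    nlinarith [mul_nonneg h1.le (neg_nonneg.mpr hneg), mul_pos h0 h2]

theorem add_two_mul_esymOn_add_two (s : Finset ι) (k : ℕ) (x : ι → ℝ) :
    (k + 2) * esymOn s (k + 2) x =
      (∑ i ∈ s, x i) * esymOn s (k + 1) x - ∑ i ∈ s, x i ^ 2 * esymOn (s.erase i) k x := by
  have h := sum_mul_esymOn_erase s (k + 1) x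
  push_cast at h
  rw [show (k : ℝ) + 2 = k + 1 + 1 by ring, ← h, Finset.sum_mul, ← Finset.sum_sub_distrib]
  refine Finset.sum_congr rfl fun i hi => ?_
  rw [esymOn_succ_of_mem hi k]
  ring

theorem add_two_mul_esymOn_le {s : Finset ι} {k : ℕ} {x : ι → ℝ} (hx : x ∈ esymCone s (k + 1)) :
    (k + 2) * esymOn s (k + 2) x ≤ esymOn s 1 x * esymOn s (k + 1) x := by
  rw [add_two_mul_esymOn_add_two, esymOn_one]
  exact sub_le_self _ (Finset.sum_nonneg fun i hi =>
    mul_nonneg (sq_nonneg _) (mem_esymCone_erase hx hi k le_rfl).le)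

theorem add_esymRatio_erase {s : Finset ι} {k : ℕ} {x : ι → ℝ} (hx : x ∈ esymCone s (k + 1))
    {i : ι} (hi : i ∈ s) :
    x i + esymRatio (s.erase i) k x = esymOn s (k + 1) x / esymOn (s.erase i) k x := by
  have h := mem_esymCone_erase hx hi k le_rfl
  rw [esymRatio, esymOn_succ_of_mem hi]
  field_simp

theorem add_esymRatio_erase_pos {s : Finset ι} {k : ℕ} {x : ι → ℝ}
    (hx : x ∈ esymCone s (k + 1)) {i : ι} (hi : i ∈ s) :
    0 < x i + esymRatio (s.erase i) k x := by
  rw [add_esymRatio_erase hx hi]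
  exact div_pos (hx _ le_rfl) (mem_esymCone_erase hx hi k le_rfl)

theorem add_two_mul_esymRatio {s : Finset ι} {k : ℕ} {x : ι → ℝ} (hx : x ∈ esymCone s (k + 1)) :
    (k + 2) * esymRatio s (k + 1) x =
      ∑ i ∈ s, (x i - x i ^ 2 / (x i + esymRatio (s.erase i) k x)) := by
  have h0 := hx (k + 1) le_rfl
  rw [esymRatio, ← mul_div_assoc, add_two_mul_esymOn_add_two, sub_div,
    mul_div_cancel_right₀ _ h0.ne', Finset.sum_div, ← Finset.sum_sub_distrib]
  refine Finset.sum_congr rfl fun i hi => ?_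
  rw [add_esymRatio_erase hx hi, div_div_eq_mul_div]

theorem add_sq_div_le {a b u v w : ℝ} (hu : 0 < u) (hv : 0 < v) (hw : u + v ≤ w) :
    (a + b) ^ 2 / w ≤ a ^ 2 / u + b ^ 2 / v := by
  calc (a + b) ^ 2 / w ≤ (a + b) ^ 2 / (u + v) := by gcongr
    _ ≤ a ^ 2 / u + b ^ 2 / v := by
      rw [div_add_div _ _ hu.ne' hv.ne', div_le_div_iff₀ (by positivity) (by positivity)]
      nlinarith [sq_nonneg (a * v - b * u), mul_pos hu hv]

theorem esymCone_add_and_esymRatio_superadditive (k : ℕ) (s : Finset ι) {x y : ι → ℝ}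
    (hx : x ∈ esymCone s (k + 1)) (hy : y ∈ esymCone s (k + 1)) :
    x + y ∈ esymCone s (k + 1) ∧
      esymRatio s k x + esymRatio s k y ≤ esymRatio s k (x + y) := by
  induction k generalizing s with
  | zero =>
    have h : esymOn s 1 (x + y) = esymOn s 1 x + esymOn s 1 y := by
      simp [esymOn_one, Finset.sum_add_distrib]
    refine ⟨mem_esymCone_succ.mpr ⟨fun j hj => ?_, ?_⟩, ?_⟩
    · rw [Nat.le_zero.mp hj, esymOn_zero]
      exact one_pos
    · rw [zero_add, h]
      exact add_pos (hx 1 le_rfl) (hy 1 le_rfl)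
    · simp [esymRatio, esymOn_zero, h]
  | succ k ih =>
    have hx' := esymCone_anti s (Nat.le_succ _) hx
    have hy' := esymCone_anti s (Nat.le_succ _) hy
    have hxy := (ih s hx' hy').1
    have hle : esymRatio s (k + 1) x + esymRatio s (k + 1) y ≤ esymRatio s (k + 1) (x + y) := by
      have hk : (0 : ℝ) < k + 2 := by positivity
      rw [← mul_le_mul_iff_right₀ hk, mul_add, add_two_mul_esymRatio hx', add_two_mul_esymRatio hy',
        add_two_mul_esymRatio hxy, ← Finset.sum_add_distrib]
      refine Finset.sum_le_sum fun i hi => ?_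
      have hi' := (ih (s.erase i) (mem_esymCone_erase hx hi) (mem_esymCone_erase hy hi)).2
      have := add_sq_div_le (a := x i) (b := y i) (add_esymRatio_erase_pos hx' hi)
        (add_esymRatio_erase_pos hy' hi)
        (w := (x + y) i + esymRatio (s.erase i) k (x + y)) (by
          rw [Pi.add_apply]
          linarith)
      simp only [Pi.add_apply] at this ⊢
      linarith
    refine ⟨mem_esymCone_succ.mpr ⟨hxy, ?_⟩, hle⟩
    have hpos : 0 < esymRatio s (k + 1) (x + y) := lt_of_lt_of_le (add_pos
      (div_pos (hx _ le_rfl) (hx' _ le_rfl)) (div_pos (hy _ le_rfl) (hy' _ le_rfl))) hle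
    exact (div_pos_iff_of_pos_right (hxy _ le_rfl)).mp hpos

/-- Mahler's inequality: the geometric mean is superadditive. -/
theorem rpow_prod_add_le {κ : Type*} (s : Finset κ) (hs : s.Nonempty) {a b : κ → ℝ}
    (ha : ∀ i ∈ s, 0 < a i) (hb : ∀ i ∈ s, 0 < b i) :
    (∏ i ∈ s, a i) ^ (1 / (s.card : ℝ)) + (∏ i ∈ s, b i) ^ (1 / (s.card : ℝ)) ≤
      (∏ i ∈ s, (a i + b i)) ^ (1 / (s.card : ℝ)) := by
  have hc : (0 : ℝ) < s.card := by exact_mod_cast hs.card_pos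
  have amgm : ∀ z : κ → ℝ, (∀ i ∈ s, 0 < z i) →
      (∏ i ∈ s, z i) ^ (1 / (s.card : ℝ)) ≤ ∑ i ∈ s, 1 / (s.card : ℝ) * z i := by
    intro z hz
    rw [← Real.finsetProd_rpow s z fun i hi => (hz i hi).le]
    refine Real.geom_mean_le_arith_mean_weighted s _ z (fun i _ => by positivity) ?_
      fun i hi => (hz i hi).le
    rw [Finset.sum_const, nsmul_eq_mul]
    field_simp
  have hab : ∀ i ∈ s, 0 < a i + b i := fun i hi => add_pos (ha i hi) (hb i hi)
  have h1 := amgm (fun i => a i / (a i + b i)) fun i hi => div_pos (ha i hi) (hab i hi)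
  have h2 := amgm (fun i => b i / (a i + b i)) fun i hi => div_pos (hb i hi) (hab i hi)
  have h3 : ∑ i ∈ s, 1 / (s.card : ℝ) * (a i / (a i + b i)) +
      ∑ i ∈ s, 1 / (s.card : ℝ) * (b i / (a i + b i)) = 1 := by
    rw [← Finset.sum_add_distrib]
    have : ∀ i ∈ s, 1 / (s.card : ℝ) * (a i / (a i + b i)) +
        1 / (s.card : ℝ) * (b i / (a i + b i)) = 1 / (s.card : ℝ) := by
      intro i hi
      rw [← mul_add, ← add_div, div_self (hab i hi).ne', mul_one]
    rw [Finset.sum_congr rfl this, Finset.sum_const, nsmul_eq_mul]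
    field_simp
  have hP := Finset.prod_pos hab
  rw [Finset.prod_div_distrib, Real.div_rpow (Finset.prod_pos ha).le hP.le] at h1
  rw [Finset.prod_div_distrib, Real.div_rpow (Finset.prod_pos hb).le hP.le] at h2
  have h4 := add_le_add h1 h2
  rwa [h3, ← add_div, div_le_one (Real.rpow_pos_of_pos hP _)] at h4

theorem esymOn_rpow_superadditive {s : Finset ι} {k : ℕ} (hk : 1 ≤ k) {x y : ι → ℝ}
    (hx : x ∈ esymCone s k) (hy : y ∈ esymCone s k) :
    x + y ∈ esymCone s k ∧ esymOn s k x ^ (1 / (k : ℝ)) + esymOn s k y ^ (1 / (k : ℝ)) ≤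
      esymOn s k (x + y) ^ (1 / (k : ℝ)) := by
  have hxy : x + y ∈ esymCone s k := by
    obtain ⟨m, rfl⟩ := Nat.exists_eq_add_of_le' hk
    exact (esymCone_add_and_esymRatio_superadditive m s hx hy).1
  refine ⟨hxy, ?_⟩
  have hpos : ∀ z ∈ esymCone s k, ∀ j ∈ Finset.range k, 0 < esymRatio s j z := fun z hz j hj =>
    div_pos (hz _ (Finset.mem_range.mp hj)) (hz _ (Finset.mem_range.mp hj).le)
  have h := rpow_prod_add_le (Finset.range k) (Finset.nonempty_range_iff.mpr (by omega))
    (hpos x hx) (hpos y hy)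
  rw [Finset.card_range, prod_esymRatio hx, prod_esymRatio hy] at h
  refine h.trans ?_
  rw [← prod_esymRatio hxy]
  refine Real.rpow_le_rpow
    (Finset.prod_nonneg fun j hj => (add_pos (hpos x hx j hj) (hpos y hy j hj)).le)
    (Finset.prod_le_prod (fun j hj => (add_pos (hpos x hx j hj) (hpos y hy j hj)).le)
      fun j hj => ?_) (by positivity)
  have hj' : j + 1 ≤ k := Finset.mem_range.mp hj
  exact (esymCone_add_and_esymRatio_superadditive j s (esymCone_anti s hj' hx)
    (esymCone_anti s hj' hy)).2

theorem concaveOn_esymOn_rpow (s : Finset ι) {k : ℕ} (hk : 1 ≤ k) :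
    ConcaveOn ℝ (esymCone s k) fun x => esymOn s k x ^ (1 / (k : ℝ)) := by
  have hsmul : ∀ x ∈ esymCone s k, ∀ c : ℝ, 0 < c →
      esymOn s k (c • x) ^ (1 / (k : ℝ)) = c * esymOn s k x ^ (1 / (k : ℝ)) := by
    intro x hx c hc
    rw [esymOn_smul, Real.mul_rpow (pow_pos hc k).le (hx k le_rfl).le, one_div,
      Real.pow_rpow_inv_natCast hc.le (by omega)]
  refine concaveOn_iff_forall_pos.mpr ⟨convex_iff_forall_pos.mpr ?_, ?_⟩
  · intro x hx y hy a b ha hb _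
    exact (esymOn_rpow_superadditive hk (smul_mem_esymCone hx ha) (smul_mem_esymCone hy hb)).1
  · intro x hx y hy a b ha hb _
    have h := (esymOn_rpow_superadditive hk (smul_mem_esymCone hx ha)
      (smul_mem_esymCone hy hb)).2
    rwa [hsmul x hx a ha, hsmul y hy b hb] at h

end ElementarySymmetric

theorem Gamma_subset_esymCone {n k : ℕ} (hk : k ≤ n) :
    Gamma n k ⊆ esymCone Finset.univ k := by
  have hcont : ∀ j, Continuous fun x : Fin n → ℝ => esymOn Finset.univ j x := by
    intro j
    unfold esymOn
    fun_prop
  have hone : ∀ j ≤ k, 0 < esymOn Finset.univ j fun _ : Fin n => (1 : ℝ) := by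
    intro j hj
    simpa [esymOn] using Nat.choose_pos (hj.trans hk)
  have hopen : IsOpen (esymCone (Finset.univ : Finset (Fin n)) k) := by
    have : esymCone (Finset.univ : Finset (Fin n)) k =
        ⋂ j ∈ Set.Iic k, {x | 0 < esymOn Finset.univ j x} := by
      ext x
      simp [esymCone]
    rw [this]
    exact (Set.finite_Iic k).isOpen_biInter fun j _ => isOpen_lt continuous_const (hcont j)
  refine isPreconnected_connectedComponentIn.subset_of_closure_inter_subset hopen
    ⟨fun _ => 1, mem_connectedComponentIn (hone k le_rfl), hone⟩ ?_
  rintro x ⟨hx, hxk⟩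
  have hpos : 0 < esymOn Finset.univ k x :=
    connectedComponentIn_subset {x : Fin n → ℝ | 0 < esym n k x} (fun _ => 1) hxk
  have hnonneg : ∀ j ≤ k, 0 ≤ esymOn Finset.univ j x := fun j hj =>
    closure_minimal (fun y hy => (hy j hj).le) (isClosed_le continuous_const (hcont j)) hx
  have hle : ∀ j, j + 2 ≤ k → (j + 2) * esymOn Finset.univ (j + 2) x ≤
      esymOn Finset.univ 1 x * esymOn Finset.univ (j + 1) x := fun j hj =>
    closure_minimal
      (t := {x | (j + 2) * esymOn Finset.univ (j + 2) x ≤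
        esymOn Finset.univ 1 x * esymOn Finset.univ (j + 1) x})
      (fun y hy => add_two_mul_esymOn_le (esymCone_anti _ (by omega) hy))
      (isClosed_le (continuous_const.mul (hcont _)) ((hcont _).mul (hcont _))) hx
  intro j hj
  induction hj using Nat.decreasingInduction with
  | self => exact hpos
  | of_succ j hj ih =>
    cases j with
    | zero =>
      rw [esymOn_zero]
      exact one_pos
    | succ j =>
      refine (hnonneg _ hj.le).lt_of_ne fun h => ?_
      have h' := hle j hj
      rw [← h, mul_zero] at h'
      exact absurd h' (not_le.mpr (by positivity))

theorem esymOn_univ_comp_perm {n : ℕ} (j : ℕ) (e : Equiv.Perm (Fin n)) (x : Fin n → ℝ) :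
    esymOn Finset.univ j (x ∘ e) = esymOn Finset.univ j x := by
  unfold esymOn
  refine Finset.sum_bij' (fun t _ => t.map e.toEmbedding) (fun t _ => t.map e.symm.toEmbedding)
    ?_ ?_ ?_ ?_ ?_ <;> simp [Finset.mem_powersetCard, Finset.map_map]

theorem doublyStochastic_mulVec_mem_and_le {n k : ℕ} (hk : 1 ≤ k) {x : Fin n → ℝ}
    (hx : x ∈ esymCone Finset.univ k) {M : Matrix (Fin n) (Fin n) ℝ}
    (hM : M ∈ doublyStochastic ℝ (Fin n)) :
    M *ᵥ x ∈ esymCone Finset.univ k ∧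
      esymOn Finset.univ k x ^ (1 / (k : ℝ)) ≤ esymOn Finset.univ k (M *ᵥ x) ^ (1 / (k : ℝ)) := by
  have hconv := ((concaveOn_esymOn_rpow (Finset.univ : Finset (Fin n)) hk).convex_ge
    (esymOn Finset.univ k x ^ (1 / (k : ℝ)))).is_linear_preimage
    (f := fun M : Matrix (Fin n) (Fin n) ℝ => M *ᵥ x)
    ⟨fun A B => Matrix.add_mulVec A B x, fun c A => Matrix.smul_mulVec c A x⟩
  rw [← SetLike.mem_coe, doublyStochastic_eq_convexHull_permMatrix] at hM
  refine convexHull_min ?_ hconv hM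
  rintro _ ⟨e, rfl⟩
  have h : e.permMatrix ℝ *ᵥ x = x ∘ e := Matrix.permMatrix_mulVec e
  simp only [Set.mem_preimage, Set.mem_ofPred_eq, h, esymOn_univ_comp_perm, le_refl, and_true]
  intro j hj
  rw [esymOn_univ_comp_perm]
  exact hx j hj

theorem sq_entries_mem_doublyStochastic {n : ℕ} {W : Matrix (Fin n) (Fin n) ℝ}
    (h1 : W * Wᵀ = 1) (h2 : Wᵀ * W = 1) :
    (Matrix.of fun i j => W i j ^ 2) ∈ doublyStochastic ℝ (Fin n) := by
  rw [mem_doublyStochastic_iff_sum]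
  refine ⟨fun i j => sq_nonneg _, fun i => ?_, fun j => ?_⟩
  · simpa [Matrix.mul_apply, sq] using congrFun (congrFun h1 i) i
  · simpa [Matrix.mul_apply, sq] using congrFun (congrFun h2 j) j

theorem exists_mul_diagonal_mul_transpose {n : ℕ} {A : Matrix (Fin n) (Fin n) ℝ}
    (hA : A.IsHermitian) : ∃ V : Matrix (Fin n) (Fin n) ℝ,
      V * Vᵀ = 1 ∧ Vᵀ * V = 1 ∧ A = V * Matrix.diagonal hA.eigenvalues * Vᵀ := by
  have hU := hA.eigenvectorUnitary.2
  refine ⟨hA.eigenvectorUnitary, ?_, ?_, ?_⟩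
  · simpa [Matrix.star_eq_conjTranspose] using (Unitary.mem_iff.mp hU).2
  · simpa [Matrix.star_eq_conjTranspose] using (Unitary.mem_iff.mp hU).1
  · have h := hA.spectral_theorem
    rw [Unitary.conjStarAlgAut_apply] at h
    simpa [Matrix.star_eq_conjTranspose, Function.comp_def] using h

/-- The diagonal of a symmetric matrix in any orthonormal basis is the image of its eigenvalue
vector under a doubly stochastic matrix. -/
theorem exists_doublyStochastic_diag {n : ℕ} {A : Matrix (Fin n) (Fin n) ℝ} (hA : A.IsHermitian)
    {U : Matrix (Fin n) (Fin n) ℝ} (h1 : U * Uᵀ = 1) (h2 : Uᵀ * U = 1) :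
    ∃ M ∈ doublyStochastic ℝ (Fin n), (Uᵀ * A * U).diag = M *ᵥ hA.eigenvalues := by
  obtain ⟨V, hV1, hV2, hV⟩ := exists_mul_diagonal_mul_transpose hA
  refine ⟨_, sq_entries_mem_doublyStochastic (W := Uᵀ * V) ?_ ?_, ?_⟩
  · rw [Matrix.transpose_mul, Matrix.transpose_transpose, Matrix.mul_assoc,
      ← Matrix.mul_assoc V, hV1, Matrix.one_mul, h2]
  · rw [Matrix.transpose_mul, Matrix.transpose_transpose, Matrix.mul_assoc,
      ← Matrix.mul_assoc U, h1, Matrix.one_mul, hV2]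
  · have h : Uᵀ * A * U = (Uᵀ * V) * Matrix.diagonal hA.eigenvalues * (Uᵀ * V)ᵀ := by
      conv_lhs => rw [hV]
      simp only [Matrix.transpose_mul, Matrix.transpose_transpose, Matrix.mul_assoc]
    rw [h]
    ext i
    rw [Matrix.diag_apply, Matrix.mul_apply]
    simp only [Matrix.mul_diagonal, Matrix.transpose_apply, Matrix.mulVec, dotProduct,
      Matrix.of_apply]
    exact Finset.sum_congr rfl fun j _ => by ring

/-- `A ↦ σ_k(A)^{1/k}` is concave on symmetric matrices with eigenvalues in `Γ_k^+`:
`σ_k((1-t)A + tB)^{1/k} ≥ (1-t) σ_k(A)^{1/k} + t σ_k(B)^{1/k}` for `t ∈ [0,1]`. -/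
theorem sigma_pow_concave {n k : ℕ} (h1 : 1 ≤ k) (hk : k ≤ n)
    (A B : Matrix (Fin n) (Fin n) ℝ) (hA : inGamma n k A) (hB : inGamma n k B)
    (t : ℝ) (ht : t ∈ Set.Icc (0 : ℝ) 1) :
    (1 - t) * Real.rpow (msigma k A) (1 / k) + t * Real.rpow (msigma k B) (1 / k) ≤
      Real.rpow (msigma k ((1 - t) • A + t • B)) (1 / k) := by

  obtain ⟨hAh, hAG⟩ := hA
  obtain ⟨hBh, hBG⟩ := hB
  have hCh : ((1 - t) • A + t • B).IsHermitian :=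
    (hAh.smul (IsSelfAdjoint.all _)).add (hBh.smul (IsSelfAdjoint.all _))
  obtain ⟨U, hU1, hU2, hU⟩ := exists_mul_diagonal_mul_transpose hCh
  obtain ⟨M, hM, hMA⟩ := exists_doublyStochastic_diag hAh hU1 hU2
  obtain ⟨N, hN, hNB⟩ := exists_doublyStochastic_diag hBh hU1 hU2
  have heig : hCh.eigenvalues = (1 - t) • (M *ᵥ hAh.eigenvalues) + t • (N *ᵥ hBh.eigenvalues) := by
    rw [← hMA, ← hNB, ← Matrix.diag_smul, ← Matrix.diag_smul, ← Matrix.diag_add]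
    have : (1 - t) • (Uᵀ * A * U) + t • (Uᵀ * B * U) = Uᵀ * ((1 - t) • A + t • B) * U := by
      simp [Matrix.mul_add, Matrix.add_mul]
    rw [this]
    conv_rhs => rw [hU]
    rw [← Matrix.mul_assoc, ← Matrix.mul_assoc, hU2, Matrix.one_mul, Matrix.mul_assoc, hU2,
      Matrix.mul_one, Matrix.diag_diagonal]
  obtain ⟨hMc, hMle⟩ := doublyStochastic_mulVec_mem_and_le h1 (Gamma_subset_esymCone hk hAG) hM
  obtain ⟨hNc, hNle⟩ := doublyStochastic_mulVec_mem_and_le h1 (Gamma_subset_esymCone hk hBG) hN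
  have hconc := (concaveOn_esymOn_rpow (Finset.univ : Finset (Fin n)) h1).2 hMc hNc
    (sub_nonneg.mpr ht.2) ht.1 (sub_add_cancel 1 t)
  rw [← heig] at hconc
  simp only [msigma, dif_pos hAh, dif_pos hBh, dif_pos hCh]
  exact (add_le_add (mul_le_mul_of_nonneg_left hMle (sub_nonneg.mpr ht.2))
    (mul_le_mul_of_nonneg_left hNle ht.1)).trans hconc
end
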